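/- arXiv:1312.0850 — 2 statements merged into one kernel-verified Lean document; each statement's English description precedes it below -/
import Mathlib

section
/- Continuity of Z in space: let M be a boundedly finite Borel measure and B a bounded Borel set which is a continuity set of M, i.e. M(cl(B) \ B) = 0 where cl(B) is the closure of B. For every decreasing sequence (B_n) of bounded Borel sets with B_n ⊇ cl(B) and ⋂_n B_n = cl(B), one has Z(B_n, M) → Z(B, M) as n → ∞; moreover, for bounded Borel sets A ⊆ B' with M(B') > 0, |Z(B', M) − Z(A, M)| ≤ 2 M(B' \ A) exp(max{1, M(B')}). -/
open MeasureTheory Metric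

/-- Indicator of 1-hard-core tuples: `1` iff all pairs of distinct coordinates are at
distance at least one. (`h_0 = 1` by the empty quantification.) -/
noncomputable def hardCore {X : Type*} [MetricSpace X] (n : ℕ) (x : Fin n → X) : ℝ :=
  if ∀ i j : Fin n, i ≠ j → 1 ≤ dist (x i) (x j) then 1 else 0

/-- The generating function `Z(B, M)` of weighted 1-hard-core configurations. -/
noncomputable def genZ {X : Type*} [MetricSpace X] [MeasurableSpace X]
    (B : Set X) (M : Measure X) : ℝ :=
  ∑' n : ℕ, ((-1 : ℝ) ^ n / n.factorial) *
    ∫ x in (Set.univ.pi fun _ : Fin n => B), hardCore n x ∂(Measure.pi fun _ : Fin n => M)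

/-- The unit partition number `κ(B)`: the least `k` such that `B` is a disjoint union of
`k` Borel sets of diameter less than one (`⊤` if there is no such finite partition). -/
noncomputable def kappa {X : Type*} [MetricSpace X] [MeasurableSpace X] (B : Set X) : ℕ∞ :=
  sInf {k : ℕ∞ | ∃ m : ℕ, k = (m : ℕ∞) ∧ ∃ A : Fin m → Set X,
    (∀ i, MeasurableSet (A i)) ∧ (∀ i, EMetric.diam (A i) < 1) ∧
    Pairwise (Function.onFun Disjoint A) ∧ B = ⋃ i, A i}

theorem pow_succ_sub_pow_succ_le {a b : ℝ} (ha : 0 ≤ a) (hab : a ≤ b) (n : ℕ) :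
    b ^ (n + 1) - a ^ (n + 1) ≤ (n + 1) * b ^ n * (b - a) := by
  induction n with
  | zero => simp
  | succ n ih =>
    have hpow : a ^ (n + 1) ≤ b ^ (n + 1) := pow_le_pow_left₀ ha hab _
    have h₁ := mul_le_mul_of_nonneg_left ih (ha.trans hab)
    have h₂ := mul_le_mul_of_nonneg_right hpow (sub_nonneg.2 hab)
    push_cast
    calc b ^ (n + 1 + 1) - a ^ (n + 1 + 1)
        = b * (b ^ (n + 1) - a ^ (n + 1)) + a ^ (n + 1) * (b - a) := by ring
      _ ≤ b * ((n + 1) * b ^ n * (b - a)) + b ^ (n + 1) * (b - a) := add_le_add h₁ h₂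
      _ = (n + 1 + 1) * b ^ (n + 1) * (b - a) := by ring

theorem norm_hardCore_le_one {X : Type*} [MetricSpace X] (n : ℕ) (x : Fin n → X) :
    ‖hardCore n x‖ ≤ 1 := by
  unfold hardCore
  split_ifs <;> simp

theorem measureReal_pi_const {X : Type*} [MeasurableSpace X] {M : Measure X} [SigmaFinite M]
    (n : ℕ) (B : Set X) :
    (Measure.pi fun _ : Fin n => M).real (Set.univ.pi fun _ => B) = M.real B ^ n := by
  simp [Measure.real, Measure.pi_pi]

theorem measure_pi_const_lt_top {X : Type*} [MeasurableSpace X] {M : Measure X} [SigmaFinite M]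
    {B : Set X} (n : ℕ) (hB : M B < ⊤) :
    (Measure.pi fun _ : Fin n => M) (Set.univ.pi fun _ => B) < ⊤ := by
  simpa [Measure.pi_pi] using ENNReal.pow_lt_top hB

theorem norm_setIntegral_hardCore_le {X : Type*} [MetricSpace X] [MeasurableSpace X]
    {M : Measure X} [SigmaFinite M] {B : Set X} (n : ℕ) (hB : M B < ⊤) :
    ‖∫ x in (Set.univ.pi fun _ : Fin n => B), hardCore n x ∂(Measure.pi fun _ : Fin n => M)‖
      ≤ M.real B ^ n := by
  have h := norm_setIntegral_le_of_norm_le_const (measure_pi_const_lt_top n hB)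
    (fun x _ => norm_hardCore_le_one n x)
  rwa [one_mul, measureReal_pi_const] at h

theorem summable_genZ {X : Type*} [MetricSpace X] [MeasurableSpace X]
    {M : Measure X} [SigmaFinite M] {B : Set X} (hB : M B < ⊤) :
    Summable fun n : ℕ => ((-1 : ℝ) ^ n / n.factorial) *
      ∫ x in (Set.univ.pi fun _ : Fin n => B), hardCore n x
        ∂(Measure.pi fun _ : Fin n => M) := by
  refine Summable.of_norm_bounded (Real.summable_pow_div_factorial (M.real B)) fun n => ?_
  rw [norm_mul, norm_div, norm_pow, norm_neg, norm_one, one_pow, Real.norm_natCast,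
    div_mul_eq_mul_div, one_mul]
  gcongr
  exact norm_setIntegral_hardCore_le n hB

section

variable {X : Type*} [MetricSpace X] [SecondCountableTopology X] [MeasurableSpace X]
  [BorelSpace X]

theorem measurable_hardCore (n : ℕ) : Measurable (hardCore (X := X) n) := by
  unfold hardCore
  refine Measurable.ite ?_ measurable_const measurable_const
  simp only [Set.ofPred_forall]
  refine MeasurableSet.iInter fun i => MeasurableSet.iInter fun j =>
    MeasurableSet.iInter fun _ => ?_
  exact measurableSet_le measurable_const
    ((measurable_pi_apply i).dist (measurable_pi_apply j))

variable {M : Measure X} [SigmaFinite M] {A B : Set X}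

theorem integrableOn_hardCore (n : ℕ) (hB : M B < ⊤) :
    IntegrableOn (hardCore n) (Set.univ.pi fun _ : Fin n => B)
      (Measure.pi fun _ : Fin n => M) :=
  Measure.integrableOn_of_bounded (measure_pi_const_lt_top n hB).ne
    (measurable_hardCore n).aestronglyMeasurable
    (Filter.Eventually.of_forall (norm_hardCore_le_one n))

theorem norm_setIntegral_hardCore_sub_le (n : ℕ) (hA : MeasurableSet A) (hB : M B < ⊤)
    (hAB : A ⊆ B) :
    ‖(∫ x in (Set.univ.pi fun _ : Fin n => B), hardCore n x ∂(Measure.pi fun _ : Fin n => M)) -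
      ∫ x in (Set.univ.pi fun _ : Fin n => A), hardCore n x ∂(Measure.pi fun _ : Fin n => M)‖
      ≤ M.real B ^ n - M.real A ^ n := by
  have hsub : (Set.univ.pi fun _ : Fin n => A) ⊆ Set.univ.pi fun _ => B :=
    Set.pi_mono fun _ _ => hAB
  have hmeas : MeasurableSet (Set.univ.pi fun _ : Fin n => A) :=
    MeasurableSet.univ_pi fun _ => hA
  have hfin := measure_pi_const_lt_top n hB
  rw [← setIntegral_sdiff hmeas (integrableOn_hardCore n hB) hsub]
  have h := norm_setIntegral_le_of_norm_le_const
    ((measure_mono Set.sdiff_subset).trans_lt hfin)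
    (fun x (_ : x ∈ (Set.univ.pi fun _ : Fin n => B) \ Set.univ.pi fun _ => A) =>
      norm_hardCore_le_one n x)
  rwa [one_mul, measureReal_sdiff hsub hmeas hfin.ne, measureReal_pi_const,
    measureReal_pi_const] at h

theorem abs_genZ_sub_le (hA : MeasurableSet A) (hB : M B < ⊤) (hAB : A ⊆ B) :
    |genZ B M - genZ A M| ≤ M.real (B \ A) * Real.exp (M.real B) := by
  have hA' : M A < ⊤ := (measure_mono hAB).trans_lt hB
  unfold genZ
  rw [← (summable_genZ hB).tsum_sub (summable_genZ hA'), ← Real.norm_eq_abs]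
  have hexp : HasSum (fun n : ℕ => M.real (B \ A) * (M.real B ^ n / n.factorial))
      (M.real (B \ A) * Real.exp (M.real B)) := by
    rw [Real.exp_eq_exp_ℝ]
    exact (NormedSpace.expSeries_div_hasSum_exp (M.real B)).mul_left _
  let g : ℕ → ℝ := fun n => n.casesOn 0 fun n => M.real (B \ A) * (M.real B ^ n / n.factorial)
  have hg : HasSum g (M.real (B \ A) * Real.exp (M.real B)) := by
    rw [← hasSum_nat_add_iff' 1]
    simpa [g] using hexp
  refine tsum_of_norm_bounded hg fun n => ?_
  rw [← mul_sub, norm_mul, norm_div, norm_pow, norm_neg, norm_one, one_pow,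
    Real.norm_natCast, div_mul_eq_mul_div, one_mul]
  have h := norm_setIntegral_hardCore_sub_le n hA hB hAB
  cases n with
  | zero => simpa [g] using h
  | succ n =>
    have hle := h.trans (pow_succ_sub_pow_succ_le measureReal_nonneg
      (measureReal_mono hAB hB.ne) n)
    rw [← measureReal_sdiff hAB hA hB.ne] at hle
    refine (div_le_div_of_nonneg_right hle (by positivity)).trans_eq ?_
    simp only [g, Nat.factorial_succ]
    push_cast
    field_simp

end

/-- Continuity of `Z` in space: if `B` is a bounded Borel continuity set of `M` and
`(B_n)` is a decreasing sequence of bounded Borel sets containing `cl(B)` with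
intersection `cl(B)`, then `Z(B_n, M) → Z(B, M)`; moreover for bounded Borel `A ⊆ B'`
with `M(B') > 0`, `|Z(B', M) − Z(A, M)| ≤ 2 M(B' \ A) exp(max{1, M(B')})`. -/
theorem stmt5 {X : Type*} [MetricSpace X] [CompleteSpace X]
    [TopologicalSpace.SeparableSpace X] [MeasurableSpace X] [BorelSpace X]
    (M : Measure X) (hM : ∀ s : Set X, Bornology.IsBounded s → M s < ⊤) :
    (∀ B : Set X, MeasurableSet B → Bornology.IsBounded B →
      M (closure B \ B) = 0 →
      ∀ Bs : ℕ → Set X, (∀ n, MeasurableSet (Bs n)) →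
        (∀ n, Bornology.IsBounded (Bs n)) → Antitone Bs →
        (∀ n, closure B ⊆ Bs n) → (⋂ n, Bs n) = closure B →
        Filter.Tendsto (fun n => genZ (Bs n) M) Filter.atTop (nhds (genZ B M))) ∧
    (∀ A B' : Set X, MeasurableSet A → MeasurableSet B' → Bornology.IsBounded B' →
      A ⊆ B' → 0 < M B' →
      |genZ B' M - genZ A M| ≤
        2 * (M (B' \ A)).toReal * Real.exp (max 1 (M B').toReal)) := by
  have : SecondCountableTopology X := UniformSpace.secondCountable_of_separable X
  have : IsLocallyFiniteMeasure M :=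
    ⟨fun x => ⟨ball x 1, ball_mem_nhds x one_pos, hM _ isBounded_ball⟩⟩
  refine ⟨fun B hB _ hcl Bs hBs hBsb hanti hsub hinter => ?_,
    fun A B' hA _ hB'b hAB _ => ?_⟩
  · have hBBs : ∀ n, B ⊆ Bs n := fun n => subset_closure.trans (hsub n)
    have hlim : Filter.Tendsto (fun n => M.real (Bs n)) Filter.atTop (nhds (M.real B)) := by
      have h := tendsto_measure_iInter_atTop (μ := M)
        (fun n => (hBs n).nullMeasurableSet) hanti ⟨0, (hM _ (hBsb 0)).ne⟩
      have hBcl : M (closure B) = M B :=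
        measure_eq_measure_of_null_sdiff subset_closure hcl |>.symm
      rw [hinter, hBcl] at h
      exact (ENNReal.tendsto_toReal ((measure_mono (hBBs 0)).trans_lt (hM _ (hBsb 0))).ne).comp h
    rw [tendsto_iff_dist_tendsto_zero]
    refine squeeze_zero (fun _ => dist_nonneg) (fun n => ?_)
      (g := fun n => (M.real (Bs n) - M.real B) * Real.exp (M.real (Bs n))) ?_
    · rw [Real.dist_eq, ← measureReal_sdiff (hBBs n) hB (hM _ (hBsb n)).ne]
      exact abs_genZ_sub_le hB (hM _ (hBsb n)) (hBBs n)
    · simpa using (hlim.sub_const (M.real B)).mul ((Real.continuous_exp.tendsto _).comp hlim)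
  · refine (abs_genZ_sub_le hA (hM _ hB'b) hAB).trans ?_
    have hnonneg : 0 ≤ (M (B' \ A)).toReal := ENNReal.toReal_nonneg
    exact mul_le_mul (by simp only [Measure.real]; linarith)
      (Real.exp_le_exp.2 (le_max_right _ _)) (Real.exp_pos _).le (by positivity)
end

section
/- Asymmetric Lovász Local Lemma (Kotecký–Preiss-type condition) for the generating function: let M, N be boundedly finite Borel measures with N absolutely continuous with respect to M. If for every Borel set A of diameter less than one, ∫_A exp(N(U(x) \ A)) M(dx) ≤ 1 − exp(−N(A)), then Z(B, M) > 0 for every bounded Borel set B, and for all bounded Borel sets A, B one has Z(A ∪ B, M)/Z(B, M) ≥ exp(−N(A \ B)) > 0. -/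
open MeasureTheory Metric

/-- The set of hard-core `n`-tuples with all coordinates in `B`. -/
def hardCoreSet {X : Type*} [MetricSpace X] (n : ℕ) (B : Set X) : Set (Fin n → X) :=
  {x | (∀ i, x i ∈ B) ∧ ∀ i j, i ≠ j → 1 ≤ dist (x i) (x j)}

lemma measureReal_pi_le {X : Type*} [MeasurableSpace X] {M : Measure X} [IsFiniteMeasure M]
    (n : ℕ) (s : Set (Fin n → X)) :
    (Measure.pi fun _ : Fin n => M).real s ≤ M.real Set.univ ^ n := by
  refine (measureReal_mono (Set.subset_univ s)).trans_eq ?_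
  simp [measureReal_def, Measure.pi_univ]

lemma norm_genZ_term_le {X : Type*} [MeasurableSpace X] {M : Measure X} [IsFiniteMeasure M]
    (n : ℕ) (s : Set (Fin n → X)) :
    ‖(-1 : ℝ) ^ n / n.factorial * (Measure.pi fun _ : Fin n => M).real s‖ ≤
      M.real Set.univ ^ n / n.factorial := by
  rw [norm_mul, norm_div, norm_pow, norm_neg, norm_one, one_pow, Real.norm_natCast,
    Real.norm_of_nonneg measureReal_nonneg, one_div_mul_eq_div]
  gcongr
  exact measureReal_pi_le n s

section HardCoreSet

variable {X : Type*} [MetricSpace X]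

lemma hardCoreSet_mono (n : ℕ) : Monotone (hardCoreSet n : Set X → Set (Fin n → X)) :=
  fun _ _ h _ hx => ⟨fun i => h (hx.1 i), hx.2⟩

lemma hardCoreSet_iUnion (n : ℕ) {B : ℕ → Set X} (hB : Monotone B) :
    hardCoreSet n (⋃ k, B k) = ⋃ k, hardCoreSet n (B k) := by
  ext x
  simp only [hardCoreSet, Set.mem_iUnion, Set.mem_ofPred_eq]
  refine ⟨fun ⟨h, h'⟩ => ?_, fun ⟨k, h, h'⟩ => ⟨fun i => ⟨k, h i⟩, h'⟩⟩
  choose f hf using h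
  exact ⟨Finset.univ.sup f, fun i => hB (Finset.le_sup (Finset.mem_univ i)) (hf i), h'⟩

/-- If `A` has diameter less than one, a hard-core tuple in `F ∪ A` has at most one
coordinate in `A`. -/
lemma hardCoreSet_succ_union (n : ℕ) {A F : Set X} (hA : ∀ x ∈ A, ∀ y ∈ A, dist x y < 1) :
    hardCoreSet (n + 1) (F ∪ A) = hardCoreSet (n + 1) F ∪
      ⋃ i : Fin (n + 1),
        {x | x i ∈ A ∧ i.removeNth x ∈ hardCoreSet n (F \ Metric.ball (x i) 1)} := by
  ext x
  simp only [hardCoreSet, Set.mem_union, Set.mem_iUnion, Set.mem_ofPred_eq, Fin.removeNth,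
    Set.mem_sdiff, Metric.mem_ball, not_lt]
  constructor
  · rintro ⟨h, h'⟩
    by_cases hx : ∃ i, x i ∈ A
    · obtain ⟨i, hi⟩ := hx
      refine Or.inr ⟨i, hi, fun k => ?_, fun j k hjk => h' _ _ fun he => hjk ?_⟩
      · have hd := h' (i.succAbove k) i (Fin.succAbove_ne i k)
        exact ⟨(h _).resolve_right fun hk => (hA _ hk _ hi).not_ge hd, hd⟩
      · exact Fin.succAbove_right_injective he
    · push Not at hx
      exact Or.inl ⟨fun i => (h i).resolve_right (hx i), h'⟩
  · rintro (⟨h, h'⟩ | ⟨i, hi, h, h'⟩)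
    · exact ⟨fun i => Or.inl (h i), h'⟩
    · refine ⟨(Fin.forall_iff_succAbove i).2 ⟨Or.inr hi, fun k => Or.inl (h k).1⟩,
        fun j k hjk => ?_⟩
      obtain rfl | ⟨j, rfl⟩ := Fin.eq_self_or_eq_succAbove i j
      · obtain rfl | ⟨k, rfl⟩ := Fin.eq_self_or_eq_succAbove j k
        · exact absurd rfl hjk
        · rw [dist_comm]
          exact (h k).2
      · obtain rfl | ⟨k, rfl⟩ := Fin.eq_self_or_eq_succAbove i k
        · exact (h j).2
        · exact h' j k fun he => hjk (by rw [he])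

variable [MeasurableSpace X]

lemma genZ_restrict {M : Measure X} [SigmaFinite M] {B W : Set X} (hB : MeasurableSet B)
    (hBW : B ⊆ W) : genZ B (M.restrict W) = genZ B M := by
  unfold genZ
  simp only [Measure.restrict_pi_pi, Measure.restrict_restrict hB,
    Set.inter_eq_self_of_subset_left hBW]

lemma summable_genZ_term (B : Set X) (M : Measure X) [IsFiniteMeasure M] : Summable fun n : ℕ =>
    (-1 : ℝ) ^ n / n.factorial * (Measure.pi fun _ : Fin n => M).real (hardCoreSet n B) :=
  (Real.summable_pow_div_factorial _).of_norm_bounded fun n => norm_genZ_term_le n _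

variable [BorelSpace X] [SecondCountableTopology X]

lemma measurableSet_hardCoreSet_comp {Y : Type*} [MeasurableSpace Y] (n : ℕ)
    {f : Y → Fin n → X} (hf : Measurable f) {s : Fin n → Set Y} (hs : ∀ i, MeasurableSet (s i)) :
    MeasurableSet {y | (∀ i, y ∈ s i) ∧ ∀ i j, i ≠ j → 1 ≤ dist (f y i) (f y j)} := by
  have hf' := measurable_pi_iff.1 hf
  have h1 : MeasurableSet {y | ∀ i, y ∈ s i} := by
    rw [Set.ofPred_forall]
    exact MeasurableSet.iInter hs
  have h2 : MeasurableSet {y | ∀ i j, i ≠ j → 1 ≤ dist (f y i) (f y j)} := by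
    simp only [Set.ofPred_forall]
    exact MeasurableSet.iInter fun i => MeasurableSet.iInter fun j => MeasurableSet.iInter fun _ =>
      measurableSet_le measurable_const ((hf' i).dist (hf' j))
  exact h1.inter h2

lemma measurableSet_hardCoreSet (n : ℕ) {B : Set X} (hB : MeasurableSet B) :
    MeasurableSet (hardCoreSet n B) :=
  measurableSet_hardCoreSet_comp n measurable_id fun i => hB.preimage (measurable_pi_apply i)

lemma measurableSet_prod_hardCoreSet (n : ℕ) {A F : Set X} (hA : MeasurableSet A)
    (hF : MeasurableSet F) : MeasurableSet {p : X × (Fin n → X) |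
      p.1 ∈ A ∧ p.2 ∈ hardCoreSet n (F \ Metric.ball p.1 1)} := by
  refine (hA.preimage measurable_fst).inter (measurableSet_hardCoreSet_comp n measurable_snd
    (s := fun i => {p : X × (Fin n → X) | p.2 i ∈ F \ Metric.ball p.1 1}) fun i => ?_)
  have hi : Measurable fun p : X × (Fin n → X) => p.2 i :=
    (measurable_pi_apply i).comp measurable_snd
  exact (hF.preimage hi).diff (measurableSet_lt (hi.dist measurable_fst) measurable_const)

lemma genZ_eq_tsum (B : Set X) (M : Measure X) :
    genZ B M = ∑' n : ℕ, (-1 : ℝ) ^ n / n.factorial *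
      (Measure.pi fun _ : Fin n => M).real (hardCoreSet n B) := by
  unfold genZ
  congr 1 with n
  congr 1
  have hu : MeasurableSet {x : Fin n → X | ∀ i j, i ≠ j → 1 ≤ dist (x i) (x j)} := by
    simpa [hardCoreSet] using measurableSet_hardCoreSet n (MeasurableSet.univ (α := X))
  have : (hardCore n : (Fin n → X) → ℝ) =
      {x : Fin n → X | ∀ i j, i ≠ j → 1 ≤ dist (x i) (x j)}.indicator 1 := by
    ext x
    simp only [hardCore, Set.indicator_apply, Set.mem_ofPred_eq, Pi.one_apply]
  rw [this, integral_indicator_one hu, measureReal_restrict_apply hu]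
  congr 1
  ext x
  simp [hardCoreSet, and_comm]

lemma genZ_empty (M : Measure X) : genZ ∅ M = 1 := by
  rw [genZ_eq_tsum, tsum_eq_single 0]
  · simp [hardCoreSet, measureReal_def]
  · intro n hn
    have : hardCoreSet n (∅ : Set X) = ∅ :=
      Set.eq_empty_of_forall_notMem fun x hx => hx.1 ⟨0, Nat.pos_of_ne_zero hn⟩
    simp [this]

variable {M : Measure X} [IsFiniteMeasure M]

lemma tendsto_genZ_iUnion {B : ℕ → Set X} (hB : Monotone B) :
    Filter.Tendsto (fun k => genZ (B k) M) Filter.atTop (nhds (genZ (⋃ k, B k) M)) := by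
  simp only [genZ_eq_tsum]
  refine tendsto_tsum_of_dominated_convergence
    (Real.summable_pow_div_factorial (M.real Set.univ)) (fun n => ?_)
    (Filter.Eventually.of_forall fun k n => norm_genZ_term_le n _)
  rw [hardCoreSet_iUnion n hB]
  refine ((ENNReal.tendsto_toReal (measure_ne_top _ _)).comp
    (tendsto_measure_iUnion_atTop fun i j hij => ?_)).const_mul _
  exact hardCoreSet_mono n (hB hij)

lemma measurable_measure_hardCoreSet (n : ℕ) {F : Set X} (hF : MeasurableSet F) :
    Measurable fun y => (Measure.pi fun _ : Fin n => M) (hardCoreSet n (F \ Metric.ball y 1)) := by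
  simpa using measurable_measure_prodMk_left (ν := Measure.pi fun _ : Fin n => M)
    (measurableSet_prod_hardCoreSet n (MeasurableSet.univ (α := X)) hF)

lemma measure_pi_removeNth (n : ℕ) (i : Fin (n + 1)) {A F : Set X} (hA : MeasurableSet A)
    (hF : MeasurableSet F) :
    (Measure.pi fun _ : Fin (n + 1) => M)
      {x | x i ∈ A ∧ i.removeNth x ∈ hardCoreSet n (F \ Metric.ball (x i) 1)} =
    ∫⁻ y in A, (Measure.pi fun _ : Fin n => M) (hardCoreSet n (F \ Metric.ball y 1)) ∂M := by
  have hS := measurableSet_prod_hardCoreSet n hA hF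
  have := (measurePreserving_piFinSuccAbove (fun _ : Fin (n + 1) => M) i).measure_preimage
    hS.nullMeasurableSet
  rw [Measure.prod_apply hS] at this
  refine Eq.trans ?_ (this.trans ?_)
  · rfl
  · rw [← lintegral_indicator hA]
    congr 1 with y
    by_cases hy : y ∈ A <;> simp [hy]

lemma measureReal_hardCoreSet_succ_union (n : ℕ) {A F : Set X} (hA : MeasurableSet A)
    (hF : MeasurableSet F) (hAF : Disjoint F A) (hd : ∀ x ∈ A, ∀ y ∈ A, dist x y < 1) :
    (Measure.pi fun _ : Fin (n + 1) => M).real (hardCoreSet (n + 1) (F ∪ A)) =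
      (Measure.pi fun _ : Fin (n + 1) => M).real (hardCoreSet (n + 1) F) +
      (n + 1) * ∫ y in A,
        (Measure.pi fun _ : Fin n => M).real (hardCoreSet n (F \ Metric.ball y 1)) ∂M := by
  have hm (i : Fin (n + 1)) : MeasurableSet
      {x : Fin (n + 1) → X | x i ∈ A ∧ i.removeNth x ∈ hardCoreSet n (F \ Metric.ball (x i) 1)} :=
    (MeasurableEquiv.piFinSuccAbove (fun _ => X) i).measurable
      (measurableSet_prod_hardCoreSet n hA hF)
  rw [hardCoreSet_succ_union n hd, measureReal_union, measureReal_iUnion_fintype]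
  · simp only [measureReal_def]
    rw [integral_toReal (measurable_measure_hardCoreSet n hF).aemeasurable
      (Filter.Eventually.of_forall fun y => measure_lt_top _ _)]
    simp [measure_pi_removeNth n _ hA hF]
  · intro i j hij
    refine Set.disjoint_left.2 fun x hx hx' => ?_
    obtain ⟨k, hk⟩ := (Fin.eq_self_or_eq_succAbove i j).resolve_left hij.symm
    subst hk
    exact Set.disjoint_left.1 hAF (hx.2.1 k).1 hx'.1
  · exact hm
  · refine Set.disjoint_iUnion_right.2 fun i => Set.disjoint_left.2 fun x hx hx' => ?_
    exact Set.disjoint_left.1 hAF (hx.1 i) hx'.1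
  · exact MeasurableSet.iUnion hm

lemma integrable_measureReal_hardCoreSet (n : ℕ) {F : Set X} (hF : MeasurableSet F)
    (A : Set X) : IntegrableOn
      (fun y => (Measure.pi fun _ : Fin n => M).real (hardCoreSet n (F \ Metric.ball y 1))) A M :=
  Integrable.of_bound (measurable_measure_hardCoreSet n hF).ennreal_toReal.aestronglyMeasurable
    (M.real Set.univ ^ n) (Filter.Eventually.of_forall fun y => by
      rw [Real.norm_of_nonneg measureReal_nonneg]
      exact measureReal_pi_le n _)

lemma integrableOn_genZ_diff_ball {F : Set X} (hF : MeasurableSet F) (A : Set X) :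
    IntegrableOn (fun y => genZ (F \ Metric.ball y 1) M) A M := by
  simp only [genZ_eq_tsum]
  refine Integrable.of_bound (C := ∑' n : ℕ, M.real Set.univ ^ n / n.factorial)
    (Measurable.aestronglyMeasurable ?_) (Filter.Eventually.of_forall fun y =>
      tsum_of_norm_bounded (Real.summable_pow_div_factorial _).hasSum
        fun n => norm_genZ_term_le n _)
  exact Measurable.tsum fun n => (measurable_measure_hardCoreSet n hF).ennreal_toReal.const_mul _

/-- The fundamental recursion of the generating function. -/
lemma genZ_union {A F : Set X} (hA : MeasurableSet A) (hF : MeasurableSet F)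
    (hAF : Disjoint F A) (hd : ∀ x ∈ A, ∀ y ∈ A, dist x y < 1) :
    genZ (F ∪ A) M = genZ F M - ∫ y in A, genZ (F \ Metric.ball y 1) M ∂M := by
  have hint (n : ℕ) := (integrable_measureReal_hardCoreSet (M := M) n hF A).const_mul
    ((-1 : ℝ) ^ n / n.factorial)
  have hsum : HasSum (fun n : ℕ => ∫ y in A, (-1 : ℝ) ^ n / n.factorial *
      (Measure.pi fun _ : Fin n => M).real (hardCoreSet n (F \ Metric.ball y 1)) ∂M)
      (∫ y in A, genZ (F \ Metric.ball y 1) M ∂M) := by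
    simp only [genZ_eq_tsum]
    refine hasSum_integral_of_summable_integral_norm hint ?_
    refine ((Real.summable_pow_div_factorial (M.real Set.univ)).mul_left
      (M.real A)).of_nonneg_of_le (fun n => integral_nonneg fun _ => norm_nonneg _) fun n => ?_
    refine (integral_mono (hint n).norm (integrable_const _)
      fun y => norm_genZ_term_le n _).trans_eq ?_
    simp
  rw [genZ_eq_tsum (F ∪ A), genZ_eq_tsum F, (summable_genZ_term _ M).tsum_eq_zero_add,
    (summable_genZ_term F M).tsum_eq_zero_add, ← hsum.tsum_eq, add_sub_assoc,
    ← ((summable_nat_add_iff 1).2 (summable_genZ_term F M)).tsum_sub hsum.summable]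
  congr 1
  · congr 2
    ext x
    simp [hardCoreSet]
  · congr 1 with n
    rw [measureReal_hardCoreSet_succ_union n hA hF hAF hd, integral_const_mul, Nat.factorial_succ]
    push_cast
    field_simp
    ring

end HardCoreSet

section LocalLemma

variable {X : Type*} [MetricSpace X] [MeasurableSpace X]

lemma setIntegral_le_of_le_mul_exp {M N : Measure X} {D : Set X} (hD : MeasurableSet D)
    (hcond : ∫⁻ x in D, ENNReal.ofReal (Real.exp (N.real (Metric.ball x 1 \ D))) ∂M ≤
      ENNReal.ofReal (1 - Real.exp (-N.real D)))
    {f : X → ℝ} (hf : IntegrableOn f D M) (hf0 : ∀ x ∈ D, 0 ≤ f x) {q : ℝ} (hq : 0 ≤ q)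
    (hle : ∀ x ∈ D, f x ≤ q * Real.exp (N.real (Metric.ball x 1 \ D))) :
    ∫ x in D, f x ∂M ≤ q * (1 - Real.exp (-N.real D)) := by
  have h1 : 0 ≤ 1 - Real.exp (-N.real D) := by
    simp [measureReal_nonneg]
  rw [integral_eq_lintegral_of_nonneg_ae (ae_restrict_of_forall_mem hD hf0)
    hf.aestronglyMeasurable]
  refine ENNReal.toReal_le_of_le_ofReal (mul_nonneg hq h1) ?_
  calc ∫⁻ x in D, ENNReal.ofReal (f x) ∂M
      ≤ ∫⁻ x in D, ENNReal.ofReal q *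
          ENNReal.ofReal (Real.exp (N.real (Metric.ball x 1 \ D))) ∂M :=
        setLIntegral_mono' hD fun x hx => by
          rw [← ENNReal.ofReal_mul hq]
          exact ENNReal.ofReal_le_ofReal (hle x hx)
    _ = ENNReal.ofReal q *
          ∫⁻ x in D, ENNReal.ofReal (Real.exp (N.real (Metric.ball x 1 \ D))) ∂M :=
        lintegral_const_mul' _ _ ENNReal.ofReal_ne_top
    _ ≤ ENNReal.ofReal (q * (1 - Real.exp (-N.real D))) := by
        rw [ENNReal.ofReal_mul hq]
        gcongr

variable [BorelSpace X] [SecondCountableTopology X] {M N : Measure X} [IsFiniteMeasure M]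

/-- Enlarging the part of a domain inside a set `A` of diameter less than one, given the
local lemma for the part `F` of the domain outside `A`. -/
lemma genZ_union_le_of_subset
    (hN : ∀ s : Set X, Bornology.IsBounded s → N s < ⊤)
    (hcond : ∀ A : Set X, MeasurableSet A → Metric.ediam A < 1 →
      ∫⁻ x in A, ENNReal.ofReal (Real.exp (N.real (Metric.ball x 1 \ A))) ∂M ≤
        ENNReal.ofReal (1 - Real.exp (-N.real A)))
    {A A' F : Set X} (hA : MeasurableSet A) (hA' : MeasurableSet A') (hF : MeasurableSet F)
    (hAA' : A' ⊆ A) (hFA : Disjoint F A) (hd : Metric.ediam A < 1)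
    (hpos : 0 < genZ F M)
    (hpos' : ∀ y, 0 < genZ (F \ Metric.ball y 1) M)
    (hle : ∀ y, genZ (F \ Metric.ball y 1) M ≤
      Real.exp (N.real (F ∩ Metric.ball y 1)) * genZ F M) :
    genZ (F ∪ A') M ≤ Real.exp (N.real (A \ A')) * genZ (F ∪ A) M := by
  have hdist : ∀ x ∈ A, ∀ y ∈ A, dist x y < 1 := fun x hx y hy => by
    have := (Metric.edist_le_ediam_of_mem hx hy).trans_lt hd
    rw [edist_dist] at this
    simpa using this
  have hball (y : X) : N (Metric.ball y 1) ≠ ⊤ := (hN _ Metric.isBounded_ball).ne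
  have hC := hA.diff hA'
  have hsub : ∀ y, ∀ D ⊆ A, N.real (F ∩ Metric.ball y 1) ≤ N.real (Metric.ball y 1 \ D) :=
    fun y D hD => measureReal_mono
      (fun z hz => ⟨hz.2, fun hzD => Set.disjoint_left.1 hFA hz.1 (hD hzD)⟩)
      (measure_ne_top_of_subset Set.sdiff_subset (hball y))
  have hint := integrableOn_genZ_diff_ball (M := M) hF
  have hJ' : ∫ y in A', genZ (F \ Metric.ball y 1) M ∂M ≤
      genZ F M * (1 - Real.exp (-N.real A')) := by
    refine setIntegral_le_of_le_mul_exp hA' (hcond A' hA' ((Metric.ediam_mono hAA').trans_lt hd))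
      (hint A') (fun y _ => (hpos' y).le) hpos.le fun y _ => (hle y).trans ?_
    rw [mul_comm]
    exact mul_le_mul_of_nonneg_left (Real.exp_le_exp.2 (hsub y A' hAA')) hpos.le
  have hJC : ∫ y in A \ A', genZ (F \ Metric.ball y 1) M ∂M ≤
      genZ F M * Real.exp (-N.real A') * (1 - Real.exp (-N.real (A \ A'))) := by
    refine setIntegral_le_of_le_mul_exp hC
      (hcond _ hC ((Metric.ediam_mono Set.sdiff_subset).trans_lt hd))
      (hint _) (fun y _ => (hpos' y).le) (by positivity) fun y hy => (hle y).trans ?_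
    rw [mul_comm, mul_assoc, ← Real.exp_add]
    gcongr
    rw [le_neg_add_iff_add_le, ← measureReal_union _ (hF.inter measurableSet_ball)
      (measure_ne_top_of_subset _ (hball y)) (measure_ne_top_of_subset _ (hball y))]
    · refine measureReal_mono (Set.union_subset ?_ ?_)
        (measure_ne_top_of_subset Set.sdiff_subset (hball y))
      · exact fun z hz => ⟨hdist z (hAA' hz) y hy.1, fun h => h.2 hz⟩
      · exact fun z hz => ⟨hz.2, fun h => Set.disjoint_left.1 hFA hz.1 h.1⟩
    · exact Set.disjoint_left.2 fun z hz hz' => Set.disjoint_left.1 hFA hz'.1 (hAA' hz)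
    · exact fun z hz => hdist z (hAA' hz) y hy.1
    · exact Set.inter_subset_right
  have hsplit := setIntegral_union Set.disjoint_sdiff_right hC (hint A') (hint (A \ A'))
  rw [Set.union_sdiff_cancel hAA'] at hsplit
  rw [genZ_union hA hF hFA hdist, genZ_union hA' hF (hFA.mono_right hAA')
    fun x hx y hy => hdist x (hAA' hx) y (hAA' hy), hsplit, ← div_le_iff₀' (Real.exp_pos _),
    div_eq_mul_inv, ← Real.exp_neg]
  have hc : 0 ≤ 1 - Real.exp (-N.real (A \ A')) := by
    simp [measureReal_nonneg]
  nlinarith [mul_nonneg (sub_nonneg.2 hJ') hc]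

/-- The local lemma for domains covered by finitely many sets of diameter less than one. -/
lemma genZ_le_of_subset_biUnion {ι : Type*}
    (hN : ∀ s : Set X, Bornology.IsBounded s → N s < ⊤)
    (hcond : ∀ A : Set X, MeasurableSet A → Metric.ediam A < 1 →
      ∫⁻ x in A, ENNReal.ofReal (Real.exp (N.real (Metric.ball x 1 \ A))) ∂M ≤
        ENNReal.ofReal (1 - Real.exp (-N.real A)))
    {A : ι → Set X} (hA : ∀ i, MeasurableSet (A i)) (hd : ∀ i, Metric.ediam (A i) < 1)
    (s : Finset ι) {B E : Set X} (hB : MeasurableSet B) (hE : MeasurableSet E)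
    (hBb : Bornology.IsBounded B) (hEB : E ⊆ B) (hBA : B ⊆ ⋃ i ∈ s, A i) :
    genZ E M ≤ Real.exp (N.real (B \ E)) * genZ B M := by
  classical
  induction s using Finset.strongInduction generalizing B E with
  | H s ih =>
  have hstep : ∀ t ⊆ s, genZ E M ≤ Real.exp (N.real ((B \ E) ∩ ⋃ i ∈ t, A i)) *
      genZ (E ∪ B ∩ ⋃ i ∈ t, A i) M := by
    intro t
    induction t using Finset.induction_on with
    | empty => simp
    | insert i t hit iht =>
      intro hts
      have his : i ∈ s := hts (Finset.mem_insert_self i t)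
      have hU : MeasurableSet (⋃ i ∈ t, A i) := t.measurableSet_biUnion fun i _ => hA i
      set U := ⋃ i ∈ t, A i with hUdef
      set D := E ∪ B ∩ U with hDdef
      have hDm : MeasurableSet D := hE.union (hB.inter hU)
      have hDB : D ⊆ B := Set.union_subset hEB Set.inter_subset_left
      have hFm : MeasurableSet (D \ A i) := hDm.diff (hA i)
      have hFA : D \ A i ⊆ ⋃ j ∈ s.erase i, A j := by
        rintro x ⟨hxD, hxi⟩
        obtain ⟨j, hj, hxj⟩ := Set.mem_iUnion₂.1 (hBA (hDB hxD))
        exact Set.mem_iUnion₂.2 ⟨j, Finset.mem_erase.2 ⟨fun h => hxi (h ▸ hxj), hj⟩, hxj⟩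
      have hF {G G' : Set X} (hG : MeasurableSet G) (hG' : MeasurableSet G') (hGF : G ⊆ D \ A i)
          (hGG' : G' ⊆ G) : genZ G' M ≤ Real.exp (N.real (G \ G')) * genZ G M :=
        ih _ (Finset.erase_ssubset his) hG hG'
          (hBb.subset (hGF.trans (Set.sdiff_subset.trans hDB))) hGG' (hGF.trans hFA)
      have hFpos {G : Set X} (hG : MeasurableSet G) (hGF : G ⊆ D \ A i) : 0 < genZ G M := by
        have := hF hG MeasurableSet.empty hGF (Set.empty_subset G)
        rw [genZ_empty] at this
        exact pos_of_mul_pos_right (one_pos.trans_le this) (Real.exp_pos _).le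
      have key := genZ_union_le_of_subset (M := M) (N := N) hN hcond (hB.inter (hA i))
        (hDm.inter (hA i)) hFm (Set.inter_subset_inter_left _ hDB)
        (Set.disjoint_left.2 fun x hx hx' => hx.2 hx'.2)
        ((Metric.ediam_mono Set.inter_subset_right).trans_lt (hd i))
        (hFpos hFm subset_rfl) (fun y => hFpos (hFm.diff measurableSet_ball) Set.sdiff_subset)
        fun y => by
          have := hF hFm (hFm.diff (measurableSet_ball (x := y) (ε := 1))) subset_rfl
            Set.sdiff_subset
          rwa [Set.sdiff_sdiff_right_self] at this
      rw [Set.sdiff_union_inter] at key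
      have hset : D \ A i ∪ B ∩ A i = E ∪ B ∩ ⋃ j ∈ insert i t, A j := by
        rw [Finset.set_biUnion_insert, ← hUdef, hDdef]
        ext x
        have := @hEB x
        simp only [Set.mem_union, Set.mem_sdiff, Set.mem_inter_iff]
        tauto
      have hdiff : (B \ E) ∩ U ∪ (B ∩ A i) \ (D ∩ A i) = (B \ E) ∩ ⋃ j ∈ insert i t, A j := by
        rw [Finset.set_biUnion_insert, ← hUdef, hDdef]
        ext x
        simp only [Set.mem_union, Set.mem_sdiff, Set.mem_inter_iff]
        tauto
      have hfin {S : Set X} (hS : S ⊆ B) : N S ≠ ⊤ := (hN _ (hBb.subset hS)).ne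
      rw [← hdiff, ← hset, measureReal_union
        (Set.disjoint_left.2 fun x hx hx' => hx'.2 ⟨Or.inr ⟨hx.1.1, hx.2⟩, hx'.1.2⟩)
        ((hB.inter (hA i)).diff (hDm.inter (hA i)))
        (hfin (Set.inter_subset_left.trans Set.sdiff_subset))
        (hfin (Set.sdiff_subset.trans Set.inter_subset_left)), Real.exp_add, mul_assoc]
      exact (iht ((Finset.subset_insert i t).trans hts)).trans
        (mul_le_mul_of_nonneg_left key (Real.exp_pos _).le)
  have := hstep s subset_rfl
  rwa [Set.inter_eq_self_of_subset_left (Set.sdiff_subset.trans hBA),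
    Set.inter_eq_self_of_subset_left hBA, Set.union_eq_self_of_subset_left hEB] at this

/-- The local lemma for bounded domains and finite intensity measures. -/
lemma genZ_le_exp_mul_genZ
    (hN : ∀ s : Set X, Bornology.IsBounded s → N s < ⊤)
    (hcond : ∀ A : Set X, MeasurableSet A → Metric.ediam A < 1 →
      ∫⁻ x in A, ENNReal.ofReal (Real.exp (N.real (Metric.ball x 1 \ A))) ∂M ≤
        ENNReal.ofReal (1 - Real.exp (-N.real A)))
    {B E : Set X} (hB : MeasurableSet B) (hE : MeasurableSet E)
    (hBb : Bornology.IsBounded B) (hEB : E ⊆ B) :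
    genZ E M ≤ Real.exp (N.real (B \ E)) * genZ B M := by
  rcases isEmpty_or_nonempty X with hX | hX
  · simp [Set.eq_empty_of_isEmpty]
  let A : ℕ → Set X := fun n => Metric.ball (TopologicalSpace.denseSeq X n) (1 / 3)
  let U : ℕ → Set X := fun n => ⋃ i ∈ Finset.range n, A i
  have hd (n : ℕ) : Metric.ediam (A n) < 1 := by
    refine (Metric.ediam_le_of_forall_dist_le (C := 2 / 3) fun x hx y hy => ?_).trans_lt ?_
    · have h1 : dist x _ < 1 / 3 := hx
      have h2 : dist y _ < 1 / 3 := hy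
      linarith [dist_triangle_right x y (TopologicalSpace.denseSeq X n)]
    · rw [ENNReal.ofReal_lt_one]
      norm_num
  have hUm (n : ℕ) : MeasurableSet (U n) :=
    (Finset.range n).measurableSet_biUnion fun i _ => measurableSet_ball
  have hUmono : Monotone U := fun m n hmn =>
    Set.biUnion_subset_biUnion_left (Finset.range_mono hmn)
  have hUuniv : ⋃ n, U n = Set.univ := by
    refine Set.eq_univ_of_forall fun x => ?_
    obtain ⟨n, hn⟩ := (TopologicalSpace.denseRange_denseSeq X).exists_dist_lt x
      (show (0 : ℝ) < 1 / 3 by norm_num)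
    exact Set.mem_iUnion.2 ⟨n + 1, Set.mem_iUnion₂.2 ⟨n, by simp, hn⟩⟩
  have hlim (S : Set X) : Filter.Tendsto (fun n => genZ (S ∩ U n) M) Filter.atTop
      (nhds (genZ S M)) := by
    have := tendsto_genZ_iUnion (M := M) (B := fun n => S ∩ U n)
      fun m n hmn => Set.inter_subset_inter_right S (hUmono hmn)
    rwa [← Set.inter_iUnion, hUuniv, Set.inter_univ] at this
  have hfin (n : ℕ) {G : Set X} (hG : MeasurableSet G) (hGB : G ⊆ B ∩ U n) :=
    genZ_le_of_subset_biUnion (M := M) hN hcond (fun i => measurableSet_ball) hd (Finset.range n)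
      (hB.inter (hUm n)) hG (hBb.subset Set.inter_subset_left) hGB Set.inter_subset_right
  refine le_of_tendsto_of_tendsto' (hlim E) ((hlim B).const_mul _) fun n => ?_
  have hpos : 0 < genZ (B ∩ U n) M := by
    have := hfin n MeasurableSet.empty (Set.empty_subset _)
    rw [genZ_empty] at this
    exact pos_of_mul_pos_right (one_pos.trans_le this) (Real.exp_pos _).le
  refine (hfin n (hE.inter (hUm n)) (Set.inter_subset_inter_left _ hEB)).trans ?_
  refine mul_le_mul_of_nonneg_right (Real.exp_le_exp.2 ?_) hpos.le
  exact measureReal_mono (fun x hx => ⟨hx.1.1, fun h => hx.2 ⟨h, hx.1.2⟩⟩)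
    (hN _ (hBb.subset Set.sdiff_subset)).ne

end LocalLemma

/-- Asymmetric Lovász Local Lemma (Kotecký–Preiss-type condition): let `N ≪ M` be
boundedly finite Borel measures with
`∫_A exp(N(U(x) \ A)) M(dx) ≤ 1 − exp(−N(A))` for every Borel set `A` of diameter less
than one. Then `Z(B, M) > 0` for every bounded Borel `B`, and
`Z(A ∪ B, M)/Z(B, M) ≥ exp(−N(A \ B)) > 0`. -/
theorem stmt13 {X : Type*} [MetricSpace X] [CompleteSpace X]
    [TopologicalSpace.SeparableSpace X] [MeasurableSpace X] [BorelSpace X]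
    (M N : Measure X)
    (hM : ∀ s : Set X, Bornology.IsBounded s → M s < ⊤)
    (hN : ∀ s : Set X, Bornology.IsBounded s → N s < ⊤)
    (hac : N ≪ M)
    (hcond : ∀ A : Set X, MeasurableSet A → EMetric.diam A < 1 →
      ∫⁻ x in A, ENNReal.ofReal (Real.exp ((N (Metric.ball x 1 \ A)).toReal)) ∂M ≤
        ENNReal.ofReal (1 - Real.exp (-(N A).toReal))) :
    (∀ B : Set X, MeasurableSet B → Bornology.IsBounded B → 0 < genZ B M) ∧
    (∀ A B : Set X, MeasurableSet A → MeasurableSet B →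
      Bornology.IsBounded A → Bornology.IsBounded B →
      Real.exp (-(N (A \ B)).toReal) ≤ genZ (A ∪ B) M / genZ B M ∧
      0 < Real.exp (-(N (A \ B)).toReal)) := by
  have hlf : IsLocallyFiniteMeasure M :=
    ⟨fun x => ⟨Metric.ball x 1, Metric.ball_mem_nhds x one_pos, hM _ Metric.isBounded_ball⟩⟩
  have hsc : SecondCountableTopology X := UniformSpace.secondCountable_of_separable X
  have key : ∀ B E : Set X, MeasurableSet B → MeasurableSet E → Bornology.IsBounded B → E ⊆ B →
      genZ E M ≤ Real.exp (N.real (B \ E)) * genZ B M := by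
    intro B E hB hE hBb hEB
    have hfin : IsFiniteMeasure (M.restrict B) := isFiniteMeasure_restrict.2 (hM B hBb).ne
    rw [← genZ_restrict hE hEB, ← genZ_restrict hB subset_rfl]
    exact genZ_le_exp_mul_genZ hN (fun A hA hd =>
      (lintegral_mono' (Measure.restrict_mono_measure Measure.restrict_le_self A) le_rfl).trans
        (hcond A hA hd)) hB hE hBb hEB
  have hpos : ∀ B : Set X, MeasurableSet B → Bornology.IsBounded B → 0 < genZ B M := by
    intro B hB hBb
    have h := key B ∅ hB MeasurableSet.empty hBb (Set.empty_subset B)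
    rw [← genZ_restrict MeasurableSet.empty subset_rfl, Measure.restrict_empty, genZ_empty] at h
    exact pos_of_mul_pos_right (one_pos.trans_le h) (Real.exp_pos _).le
  refine ⟨hpos, fun A B hA hB hAb hBb => ⟨?_, Real.exp_pos _⟩⟩
  have h := key (A ∪ B) B (hA.union hB) hB (hAb.union hBb) Set.subset_union_right
  rw [Set.union_sdiff_right] at h
  rwa [le_div_iff₀ (hpos B hB hBb), Real.exp_neg, inv_mul_le_iff₀ (Real.exp_pos _)]
end
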